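/- Let 𝒦 ⊆ W be a conjugacy class of W (an orbit of the ordinary conjugation action w • x = w·x·w⁻¹). If 𝒦 is quasiparabolic with respect to the height function ht = ℓ/2, then x·x = 1 for every x ∈ 𝒦; that is, every quasiparabolic conjugacy class in W consists of involutions. -/

import Mathlib

noncomputable section

variable {B W : Type*} [Group W] {M : CoxeterMatrix B}

/-- The `θ`-twisted conjugation action of `W` on itself: `w • x = w·x·θ(w)⁻¹`. -/
def twConj (θ : W ≃* W) (w x : W) : W := w * x * (θ w)⁻¹

/-- The height function `ht = ℓ/2` on `W`. -/
def htL (cs : CoxeterSystem M W) (x : W) : ℚ := (cs.length x : ℚ) / 2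

/-- `𝒦` is a `θ`-twisted conjugacy class, i.e. an orbit of the twisted conjugation action. -/
def IsTwClass (θ : W ≃* W) (𝒦 : Set W) : Prop :=
  ∃ x₀ : W, 𝒦 = Set.range fun w => twConj θ w x₀

/-- The `θ`-twisted conjugacy class `𝒦` is quasiparabolic with respect to the height
function `ht = ℓ/2`: (QP1) and (QP2) hold. -/
def IsQPClass (cs : CoxeterSystem M W) (θ : W ≃* W) (𝒦 : Set W) : Prop :=
  (∀ r : W, cs.IsReflection r → ∀ x ∈ 𝒦,
      htL cs (twConj θ r x) = htL cs x → twConj θ r x = x) ∧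
  (∀ r : W, cs.IsReflection r → ∀ x ∈ 𝒦, ∀ i : B,
      htL cs x < htL cs (twConj θ r x) →
      htL cs (twConj θ (cs.simple i) (twConj θ r x)) < htL cs (twConj θ (cs.simple i) x) →
      twConj θ r x = twConj θ (cs.simple i) x)

/-- `x` is a `W`-minimal element: `ℓ(s·x·θ(s)⁻¹) ≥ ℓ(x)` for all simple reflections `s`. -/
def TwMin (cs : CoxeterSystem M W) (θ : W ≃* W) (x : W) : Prop :=
  ∀ i : B, cs.length x ≤ cs.length (twConj θ (cs.simple i) x)

/-- The automorphism `θ` maps the set `S` of simple reflections onto itself. -/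
def SimpleOnto (cs : CoxeterSystem M W) (θ : W ≃* W) : Prop :=
  ⇑θ '' Set.range cs.simple = Set.range cs.simple

namespace CoxeterSystem

variable (cs : CoxeterSystem M W)

open Classical in
/-- The map `(t, ε) ↦ (s t s, ε + [t = s])`, with `s` the simple reflection indexed by `i`. -/
def signedConj (i : B) : Function.End (W × ZMod 2) := fun p =>
  (cs.simple i * p.1 * cs.simple i, p.2 + if p.1 = cs.simple i then 1 else 0)

open Classical in
theorem signedConj_mul_pow_apply (i j : B) (k : ℕ) (t : W) (e : ZMod 2) :
    ((cs.signedConj i * cs.signedConj j) ^ k) (t, e) =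
      ((cs.simple i * cs.simple j) ^ k * t * ((cs.simple i * cs.simple j) ^ k)⁻¹,
        e + ∑ a ∈ Finset.range (2 * k),
          if t = cs.simple j * (cs.simple i * cs.simple j) ^ a then 1 else 0) := by
  induction k with
  | zero =>
    rw [pow_zero, Function.End.one_def, id]
    simp
  | succ k ih =>
    set p := cs.simple i * cs.simple j with hp
    have hjp : cs.simple j * p * cs.simple j = p⁻¹ := by
      simp [hp, mul_assoc]
    have hpow (k : ℕ) : p ^ k * cs.simple j = cs.simple j * (p ^ k)⁻¹ := by
      have h : (cs.simple j * p * (cs.simple j)⁻¹) ^ k = (p⁻¹) ^ k := by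
        rw [cs.inv_simple, hjp]
      rw [conj_pow, inv_pow, cs.inv_simple] at h
      rw [← h]
      simp [mul_assoc]
    have hpow' (k : ℕ) : (p ^ k)⁻¹ * cs.simple j = cs.simple j * p ^ k := by
      rw [inv_mul_eq_iff_eq_mul, ← mul_assoc, hpow]
      simp
    have h₁ : p ^ k * t * (p ^ k)⁻¹ = cs.simple j ↔ t = cs.simple j * p ^ (2 * k) := by
      rw [mul_inv_eq_iff_eq_mul, ← eq_inv_mul_iff_mul_eq, ← mul_assoc, hpow', mul_assoc,
        ← pow_add, two_mul]
    have h₂ : cs.simple j * (p ^ k * t * (p ^ k)⁻¹) * cs.simple j = cs.simple i ↔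
        t = cs.simple j * p ^ (2 * k + 1) := by
      have h : cs.simple j * (p ^ k * t * (p ^ k)⁻¹) * cs.simple j = cs.simple i ↔
          p ^ k * t * (p ^ k)⁻¹ = cs.simple j * p := by
        generalize p ^ k * t * (p ^ k)⁻¹ = q
        rw [hp]
        constructor
        · intro h
          simp [← h, mul_assoc]
        · rintro rfl
          simp [mul_assoc]
      rw [h, mul_inv_eq_iff_eq_mul, ← eq_inv_mul_iff_mul_eq, ← mul_assoc, ← mul_assoc, hpow',
        mul_assoc, mul_assoc, ← pow_succ', ← pow_add]
      congr! 3
      ring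
    rw [pow_succ']
    change cs.signedConj i (cs.signedConj j (((cs.signedConj i * cs.signedConj j) ^ k) (t, e))) = _
    rw [ih, show 2 * (k + 1) = 2 * k + 1 + 1 by ring, Finset.sum_range_succ,
      Finset.sum_range_succ]
    simp only [signedConj, h₁, h₂, Prod.mk.injEq]
    constructor
    · rw [pow_succ' p k, hp]
      simp [mul_assoc]
    · ring

theorem isLiftable_signedConj : M.IsLiftable cs.signedConj := by
  classical
  intro i j
  funext ⟨t, e⟩
  rw [signedConj_mul_pow_apply, cs.simple_mul_simple_pow, two_mul, Finset.sum_range_add]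
  simp only [pow_add, cs.simple_mul_simple_pow, one_mul, CharTwo.add_self_eq_zero]
  rw [Function.End.one_def, id]
  simp

/-- The action of `W` on `W × ZMod 2` in which the simple reflections act by `signedConj`. -/
def signedConjHom : W →* Function.End (W × ZMod 2) :=
  cs.lift ⟨cs.signedConj, cs.isLiftable_signedConj⟩

open Classical in
theorem signedConjHom_wordProd_apply (ω : List B) (t : W) (e : ZMod 2) :
    cs.signedConjHom (cs.wordProd ω) (t, e) =
      (cs.wordProd ω * t * (cs.wordProd ω)⁻¹, e + ((cs.rightInvSeq ω).count t : ZMod 2)) := by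
  induction ω with
  | nil =>
    rw [cs.wordProd_nil, map_one, Function.End.one_def, id]
    simp
  | cons i ω ih =>
    have h : cs.wordProd ω * t * (cs.wordProd ω)⁻¹ = cs.simple i ↔
        (cs.wordProd ω)⁻¹ * cs.simple i * cs.wordProd ω = t := by
      constructor <;> intro h <;> rw [← h] <;> group
    rw [cs.wordProd_cons, map_mul]
    change cs.signedConjHom (cs.simple i) (cs.signedConjHom (cs.wordProd ω) (t, e)) = _
    rw [ih, signedConjHom, cs.lift_apply_simple]
    simp only [signedConj, rightInvSeq, List.count_cons, h, Prod.mk.injEq, beq_iff_eq]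
    constructor
    · simp [mul_assoc]
    · push_cast
      ring

/-- The parity of the number of occurrences of `t` in the right inversion sequence of a word
depends only on the product of the word. -/
theorem count_rightInvSeq_congr [DecidableEq W] {ω ω' : List B}
    (h : cs.wordProd ω = cs.wordProd ω') (t : W) :
    ((cs.rightInvSeq ω).count t : ZMod 2) = (cs.rightInvSeq ω').count t := by
  have h₁ := cs.signedConjHom_wordProd_apply ω t 0
  rw [h, cs.signedConjHom_wordProd_apply ω' t 0] at h₁
  have h₂ := (Prod.mk.injEq _ _ _ _ ▸ h₁).2
  simp only [zero_add] at h₂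
  convert h₂.symm

theorem simple_mem_rightInvSeq {ω : List B} {i : B}
    (h : cs.IsRightDescent (cs.wordProd ω) i) : cs.simple i ∈ cs.rightInvSeq ω := by
  classical
  obtain ⟨ω', hω', hprod⟩ := cs.exists_isReduced (cs.wordProd ω * cs.simple i)
  have hw : cs.wordProd ω = cs.wordProd (ω'.concat i) := by
    rw [cs.wordProd_concat, ← hprod]
    simp
  have hred : cs.IsReduced (ω'.concat i) := by
    have h₁ := cs.isRightDescent_iff.1 h
    rw [hprod, hω'.eq] at h₁
    rw [IsReduced, ← hw, ← h₁, List.length_concat]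
  have hmem : cs.simple i ∈ cs.rightInvSeq (ω'.concat i) := by
    rw [cs.rightInvSeq_concat]
    simp
  have hc := cs.count_rightInvSeq_congr hw (cs.simple i)
  rw [List.count_eq_one_of_mem hred.nodup_rightInvSeq hmem] at hc
  by_contra hn
  rw [List.count_eq_zero_of_not_mem hn] at hc
  simp at hc

/-- The exchange property. -/
theorem exists_wordProd_eraseIdx_eq_mul_simple {ω : List B} {i : B}
    (h : cs.IsRightDescent (cs.wordProd ω) i) :
    ∃ j < ω.length, cs.wordProd (ω.eraseIdx j) = cs.wordProd ω * cs.simple i := by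
  obtain ⟨j, hj, hji⟩ := List.getElem_of_mem (cs.simple_mem_rightInvSeq h)
  refine ⟨j, by simpa using hj, ?_⟩
  rw [← cs.wordProd_mul_getD_rightInvSeq, List.getD_eq_getElem _ _ hj, hji]

/-- If every letter of the reduced word `τ` is a right descent of `x`, then the product of `τ` is
a suffix of `x`. -/
theorem exists_eq_mul_wordProd {x : W} {τ : List B} (hτ : cs.IsReduced τ)
    (hx : ∀ i ∈ τ, cs.IsRightDescent x i) :
    ∃ z, x = z * cs.wordProd τ ∧ cs.length z + τ.length ≤ cs.length x := by
  induction τ using List.reverseRecOn with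
  | nil => exact ⟨x, by simp⟩
  | append_singleton τ i ih =>
    have hτ' : cs.IsReduced τ := by
      simpa using hτ.take τ.length
    obtain ⟨z, hz, hlen⟩ := ih hτ' fun k hk => hx k (by simp [hk])
    obtain ⟨ζ, hζ, rfl⟩ := cs.exists_isReduced z
    rw [hζ.eq] at hlen
    have hd := hx i (by simp)
    rw [hz, ← cs.wordProd_append] at hd
    obtain ⟨j, hj, hji⟩ := cs.exists_wordProd_eraseIdx_eq_mul_simple hd
    rw [List.length_append] at hj
    rcases lt_or_ge j ζ.length with hjζ | hjζ
    · refine ⟨cs.wordProd (ζ.eraseIdx j), ?_, ?_⟩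
      · rw [List.eraseIdx_append_of_lt_length hjζ, cs.wordProd_append, cs.wordProd_append,
          ← hz] at hji
        rw [cs.wordProd_append, ← mul_assoc, hji]
        simp
      · have h₁ := cs.length_wordProd_le (ζ.eraseIdx j)
        rw [List.length_eraseIdx_of_lt hjζ] at h₁
        rw [List.length_append, List.length_singleton]
        omega
    · rw [List.eraseIdx_append_of_length_le hjζ, cs.wordProd_append, cs.wordProd_append,
        mul_assoc, mul_right_inj] at hji
      have h₁ := cs.length_wordProd_le (τ.eraseIdx (j - ζ.length))
      have h₂ := hτ.eq
      rw [cs.wordProd_append, cs.wordProd_singleton, ← hji, List.length_append,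
        List.length_singleton] at h₂
      have h₃ := List.length_eraseIdx_le τ (j - ζ.length)
      omega

/-- An element with a reduced word all of whose letters are right descents is an involution. -/
theorem mul_self_eq_one_of_isRightDescent {ω : List B} (hω : cs.IsReduced ω)
    (h : ∀ i ∈ ω, cs.IsRightDescent (cs.wordProd ω) i) :
    cs.wordProd ω * cs.wordProd ω = 1 := by
  obtain ⟨z, hz, hlen⟩ := cs.exists_eq_mul_wordProd hω.reverse fun i hi =>
    h i (List.mem_reverse.1 hi)
  rw [hω.eq, List.length_reverse] at hlen
  have hz1 : z = 1 := cs.length_eq_zero_iff.1 (by omega)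
  rw [cs.wordProd_reverse, hz1, one_mul] at hz
  nth_rewrite 1 [hz]
  simp

/-- If every left descent of `x` commutes with `x`, then so does every letter of a reduced word
for `x`, and all these letters are right descents of `x`. -/
theorem isRightDescent_of_mem_of_commute {ω : List B} (hω : cs.IsReduced ω)
    (h : ∀ i, cs.IsLeftDescent (cs.wordProd ω) i → Commute (cs.simple i) (cs.wordProd ω)) :
    ∀ i ∈ ω, cs.IsRightDescent (cs.wordProd ω) i := by
  suffices H : ∀ v u : List B, ω = u ++ v → Commute (cs.wordProd u) (cs.wordProd ω) →
      ∀ i ∈ v, cs.IsRightDescent (cs.wordProd ω) i from H ω [] rfl (by simp)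
  intro v
  induction v with
  | nil => simp
  | cons k v ih =>
    intro u hu hcomm
    have hrot : cs.simple k * cs.wordProd ω = cs.wordProd (v ++ u) := by
      have h₁ : cs.wordProd ω = cs.simple k * cs.wordProd (v ++ u) := by
        have h₂ := hcomm.eq
        conv_lhs at h₂ => rw [hcomm.eq, hu]
        rw [← hcomm.eq] at h₂
        rw [← mul_right_inj (cs.wordProd u), ← h₂]
        simp [cs.wordProd_append, cs.wordProd_cons, mul_assoc]
      rw [h₁, cs.simple_mul_simple_cancel_left]
    have hleft : cs.IsLeftDescent (cs.wordProd ω) k := by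
      have h₁ := cs.length_wordProd_le (v ++ u)
      rw [IsLeftDescent, hrot, hω.eq, hu]
      simp only [List.length_append, List.length_cons] at h₁ ⊢
      omega
    have hk := h k hleft
    intro i hi
    rcases List.mem_cons.1 hi with rfl | hi
    · rw [IsRightDescent, ← hk.eq]
      exact hleft
    · refine ih (u ++ [k]) (by simp [hu]) ?_ i hi
      rw [cs.wordProd_append, cs.wordProd_singleton]
      exact hcomm.mul_left hk

end CoxeterSystem

/-- Every quasiparabolic (ordinary) conjugacy class of `W` (with respect to
the height function `ht = ℓ/2`) consists of involutions. -/
theorem stmt15 (cs : CoxeterSystem M W) (𝒦 : Set W)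
    (hK : IsTwClass (MulEquiv.refl W) 𝒦) (hqp : IsQPClass cs (MulEquiv.refl W) 𝒦) :
    ∀ x ∈ 𝒦, x * x = 1 := by
  obtain ⟨x₀, rfl⟩ := hK
  let f : W → ℕ := fun w => cs.length (twConj (MulEquiv.refl W) w x₀)
  obtain ⟨w, hw⟩ : ∃ w, ∀ v, f w ≤ f v := ⟨Function.argmin f, fun v => Function.argmin_le f v⟩
  obtain ⟨ω, hω, hprod⟩ := cs.exists_isReduced (twConj (MulEquiv.refl W) w x₀)
  have hinv : cs.wordProd ω * cs.wordProd ω = 1 := by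
    refine cs.mul_self_eq_one_of_isRightDescent hω
      (cs.isRightDescent_of_mem_of_commute hω fun i hi => ?_)
    rw [← hprod] at hi ⊢
    have hmin := hw (cs.simple i * w)
    have hconj : twConj (MulEquiv.refl W) (cs.simple i * w) x₀ =
        cs.simple i * twConj (MulEquiv.refl W) w x₀ * cs.simple i := by
      simp [twConj, mul_assoc]
    simp only [f, hconj] at hmin
    have hle := cs.length_mul_le (cs.simple i * twConj (MulEquiv.refl W) w x₀) (cs.simple i)
    rw [cs.length_simple] at hle
    rw [CoxeterSystem.IsLeftDescent] at hi
    have hfix := hqp.1 (cs.simple i) (cs.isReflection_simple i) _ ⟨w, rfl⟩ (by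
      have heq : cs.length (cs.simple i * twConj (MulEquiv.refl W) w x₀ * cs.simple i) =
          cs.length (twConj (MulEquiv.refl W) w x₀) := by omega
      simp only [htL]
      rw [twConj, MulEquiv.refl_apply, cs.inv_simple, heq])
    rw [twConj, MulEquiv.refl_apply] at hfix
    exact mul_inv_eq_iff_eq_mul.1 hfix
  rw [← hprod] at hinv
  have hx₀ : x₀ * x₀ = 1 := by
    have h : w * (x₀ * x₀) * w⁻¹ = 1 := by
      rw [← hinv]
      simp [twConj, mul_assoc]
    exact conj_eq_one_iff.1 h
  rintro _ ⟨v, rfl⟩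
  have h : v * (x₀ * x₀) * v⁻¹ = 1 := by simp [hx₀]
  rw [← h]
  simp [twConj, mul_assoc]

end
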